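/- arXiv:2605.29189 — 6 statements merged into one kernel-verified Lean document; each statement's English description precedes it below -/
import Mathlib

section
/- Let p ≥ 1 and α ∈ (0,1). If the common pFS stopping probabilities are Q_k(∅|p) = (k+1−α)/(k+1) for k = 0,…,p−1 and Q_p(∅|p) = 1, then the induced prior on model size is π(k|p) = ((k+1−α)/(k+1)) · α^k/k! for k = 0,…,p−1 and π(p|p) = α^p/p!; moreover these values sum to 1. -/
open Finset

/-- If `Q ℓ = (ℓ+1-α)/(ℓ+1)` for `ℓ < k`, the continuation probabilities `1 - Q ℓ = α/(ℓ+1)`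
multiply to `α^k/k!`. -/
theorem prod_one_sub_eq_pow_div_factorial (α : ℝ) (Q : ℕ → ℝ) (k : ℕ)
    (hQ : ∀ ℓ, ℓ < k → Q ℓ = ((ℓ : ℝ) + 1 - α) / ((ℓ : ℝ) + 1)) :
    ∏ ℓ ∈ Finset.range k, (1 - Q ℓ) = α ^ k / (k.factorial : ℝ) := by
  induction k with
  | zero => simp
  | succ k ih =>
    rw [Finset.prod_range_succ, ih fun ℓ hℓ => hQ ℓ (hℓ.trans k.lt_succ_self),
      hQ k k.lt_succ_self, Nat.factorial_succ]
    have hk : (k : ℝ) + 1 ≠ 0 := by positivity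
    have hf : (k.factorial : ℝ) ≠ 0 := by positivity
    push_cast
    field_simp
    ring

/-- The sum of `((k+1-α)/(k+1))·α^k/k! = α^k/k! - α^(k+1)/(k+1)!` telescopes. -/
theorem sum_mul_pow_div_factorial_add (α : ℝ) (p : ℕ) :
    (∑ k ∈ Finset.range p,
        (((k : ℝ) + 1 - α) / ((k : ℝ) + 1)) * α ^ k / (k.factorial : ℝ)) +
      α ^ p / (p.factorial : ℝ) = 1 := by
  induction p with
  | zero => simp
  | succ p ih =>
    rw [Finset.sum_range_succ, add_assoc, Nat.factorial_succ]
    refine Eq.trans ?_ ih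
    have hp : (p : ℝ) + 1 ≠ 0 := by positivity
    have hf : (p.factorial : ℝ) ≠ 0 := by positivity
    congr 1
    push_cast
    field_simp
    ring

/-- The Subset Holm Procedure (SHP) prior: with common pFS stopping probabilities
`Q k = (k+1-α)/(k+1)` for `k < p` and `Q p = 1`, the induced prior on model size is
`π(k|p) = ((k+1-α)/(k+1))·α^k/k!` for `k < p`, `π(p|p) = α^p/p!`, and these values
sum to one. -/
theorem SHP_size_prior (p : ℕ) (hp : 1 ≤ p) (α : ℝ) (hα : α ∈ Set.Ioo (0 : ℝ) 1)
    (Q : ℕ → ℝ) (hQ : ∀ k, k < p → Q k = ((k : ℝ) + 1 - α) / ((k : ℝ) + 1))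
    (hQp : Q p = 1) :
    (∀ k, k < p →
      (∏ ℓ ∈ Finset.range k, (1 - Q ℓ)) * Q k =
        (((k : ℝ) + 1 - α) / ((k : ℝ) + 1)) * α ^ k / (k.factorial : ℝ)) ∧
    (∏ ℓ ∈ Finset.range p, (1 - Q ℓ)) * Q p = α ^ p / (p.factorial : ℝ) ∧
    (∑ k ∈ Finset.range p,
        (((k : ℝ) + 1 - α) / ((k : ℝ) + 1)) * α ^ k / (k.factorial : ℝ)) +
      α ^ p / (p.factorial : ℝ) = 1 := by
  refine ⟨fun k hk => ?_, ?_, sum_mul_pow_div_factorial_add α p⟩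
  · rw [prod_one_sub_eq_pow_div_factorial α Q k fun ℓ hℓ => hQ ℓ (hℓ.trans hk), hQ k hk]
    ring
  · rw [prod_one_sub_eq_pow_div_factorial α Q p hQ, hQp, mul_one]
end

section
/- Let p ≥ 1 and φ, θ > 0. If the common pFS stopping probabilities are Q_k(∅|p) = (k+φ)/(k+φ+θ) for k = 0,…,p−1 and Q_p(∅|p) = 1, then the induced prior on model size is π(k|p) = ((k+φ)/(k+φ+θ)) · Γ(φ+θ)·θ^k / Γ(k+φ+θ) for k = 0,…,p−1 and π(p|p) = Γ(φ+θ)·θ^p / Γ(p+φ+θ); moreover these values sum to 1. -/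
open Finset

theorem gamma_weight_zero {φ θ : ℝ} (h : 0 < φ + θ) :
    Real.Gamma (φ + θ) * θ ^ 0 / Real.Gamma (((0 : ℕ) : ℝ) + φ + θ) = 1 := by
  have hΓ := (Real.Gamma_pos_of_pos h).ne'
  simp [div_self hΓ]

theorem gamma_weight_succ {φ θ : ℝ} (h : 0 < φ + θ) (k : ℕ) :
    Real.Gamma (φ + θ) * θ ^ (k + 1) / Real.Gamma (((k + 1 : ℕ) : ℝ) + φ + θ) =
      Real.Gamma (φ + θ) * θ ^ k / Real.Gamma ((k : ℝ) + φ + θ) *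
        (1 - ((k : ℝ) + φ) / ((k : ℝ) + φ + θ)) := by
  have hk : 0 < (k : ℝ) + φ + θ := by
    have := k.cast_nonneg (α := ℝ)
    linarith
  have hΓ := (Real.Gamma_pos_of_pos hk).ne'
  have hk' := hk.ne'
  have hs : ((k + 1 : ℕ) : ℝ) + φ + θ = ((k : ℝ) + φ + θ) + 1 := by
    push_cast
    ring
  rw [hs, Real.Gamma_add_one hk', one_sub_div hk', add_sub_cancel_left, pow_succ,
    div_mul_div_comm]
  congr 1 <;> ring

theorem prod_one_sub_eq_gamma_weight {φ θ : ℝ} (h : 0 < φ + θ) (k : ℕ) :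
    ∏ ℓ ∈ Finset.range k, (1 - ((ℓ : ℝ) + φ) / ((ℓ : ℝ) + φ + θ)) =
      Real.Gamma (φ + θ) * θ ^ k / Real.Gamma ((k : ℝ) + φ + θ) := by
  induction k with
  | zero => rw [gamma_weight_zero h, Finset.prod_range_zero]
  | succ k ih => rw [Finset.prod_range_succ, ih, gamma_weight_succ h]

theorem sum_gamma_weight_add {φ θ : ℝ} (h : 0 < φ + θ) (n : ℕ) :
    (∑ k ∈ Finset.range n,
        (((k : ℝ) + φ) / ((k : ℝ) + φ + θ)) *
          (Real.Gamma (φ + θ) * θ ^ k / Real.Gamma ((k : ℝ) + φ + θ))) +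
      Real.Gamma (φ + θ) * θ ^ n / Real.Gamma ((n : ℝ) + φ + θ) = 1 := by
  induction n with
  | zero => rw [gamma_weight_zero h, Finset.sum_range_zero, zero_add]
  | succ n ih =>
    rw [Finset.sum_range_succ, gamma_weight_succ h]
    linear_combination ih

/-- The generalized Subset Holm Procedure (SHP) prior: with common pFS stopping
probabilities `Q k = (k+φ)/(k+φ+θ)` for `k < p` and `Q p = 1`, the induced prior on
model size is `π(k|p) = ((k+φ)/(k+φ+θ))·Γ(φ+θ)·θ^k/Γ(k+φ+θ)` for `k < p`,
`π(p|p) = Γ(φ+θ)·θ^p/Γ(p+φ+θ)`, and these values sum to one. -/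
theorem generalized_SHP_size_prior (p : ℕ) (hp : 1 ≤ p)
    (φ θ : ℝ) (hφ : 0 < φ) (hθ : 0 < θ)
    (Q : ℕ → ℝ) (hQ : ∀ k, k < p → Q k = ((k : ℝ) + φ) / ((k : ℝ) + φ + θ))
    (hQp : Q p = 1) :
    (∀ k, k < p →
      (∏ ℓ ∈ Finset.range k, (1 - Q ℓ)) * Q k =
        (((k : ℝ) + φ) / ((k : ℝ) + φ + θ)) *
          (Real.Gamma (φ + θ) * θ ^ k / Real.Gamma ((k : ℝ) + φ + θ))) ∧
    (∏ ℓ ∈ Finset.range p, (1 - Q ℓ)) * Q p =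
      Real.Gamma (φ + θ) * θ ^ p / Real.Gamma ((p : ℝ) + φ + θ) ∧
    (∑ k ∈ Finset.range p,
        (((k : ℝ) + φ) / ((k : ℝ) + φ + θ)) *
          (Real.Gamma (φ + θ) * θ ^ k / Real.Gamma ((k : ℝ) + φ + θ))) +
      Real.Gamma (φ + θ) * θ ^ p / Real.Gamma ((p : ℝ) + φ + θ) = 1 := by
  have h : 0 < φ + θ := add_pos hφ hθ
  have hprod : ∀ k, k ≤ p → ∏ ℓ ∈ Finset.range k, (1 - Q ℓ) =
      Real.Gamma (φ + θ) * θ ^ k / Real.Gamma ((k : ℝ) + φ + θ) := by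
    intro k hk
    rw [← prod_one_sub_eq_gamma_weight h]
    refine Finset.prod_congr rfl fun ℓ hℓ => ?_
    rw [hQ ℓ ((Finset.mem_range.mp hℓ).trans_le hk)]
  refine ⟨fun k hk => ?_, ?_, sum_gamma_weight_add h p⟩
  · rw [hprod k hk.le, hQ k hk, mul_comm]
  · rw [hprod p le_rfl, hQp, mul_one]
end

section
/- Let α ∈ (0,1) and for θ > 0 set φ(θ) = θ·(1−α)/α. Then for every integer k ≥ 0, the generalized SHP size probability ((k+φ(θ))/(k+φ(θ)+θ)) · Γ(φ(θ)+θ)·θ^k / Γ(k+φ(θ)+θ) converges to (1−α)·α^k as θ → ∞, i.e., the PHP size prior is the θ → ∞ limit of the generalized SHP prior along φ = θ(1−α)/α. -/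
open Filter

/-- A quotient of affine functions `(b + a x) / (b + x)` tends to `a` at infinity. -/
theorem tendsto_affine_div_add_atTop (a b : ℝ) :
    Tendsto (fun x : ℝ => (b + a * x) / (b + x)) atTop (nhds a) := by
  have hb : Tendsto (fun x : ℝ => b / x) atTop (nhds 0) := tendsto_const_nhds.div_atTop tendsto_id
  have h := (hb.add_const a).div (hb.add_const 1) (by norm_num)
  simp only [zero_add, div_one] at h
  refine h.congr' ?_
  filter_upwards [eventually_gt_atTop 0] with x hx
  simp only [Pi.div_apply]
  rw [div_add' _ _ _ hx.ne', div_add' _ _ _ hx.ne', div_div_div_cancel_right₀ hx.ne', one_mul]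

/-- `Γ(x + k) ~ Γ(x) x ^ k` as `x → ∞`, for a natural number `k`. -/
theorem tendsto_Gamma_mul_pow_div_Gamma_add (k : ℕ) :
    Tendsto (fun x : ℝ => Real.Gamma x * x ^ k / Real.Gamma (k + x)) atTop (nhds 1) := by
  induction k with
  | zero =>
    refine tendsto_const_nhds.congr' ?_
    filter_upwards [eventually_gt_atTop 0] with x hx
    simp [(Real.Gamma_pos_of_pos hx).ne']
  | succ k ih =>
    have hb : Tendsto (fun x : ℝ => (k : ℝ) / x) atTop (nhds 0) :=
      tendsto_const_nhds.div_atTop tendsto_id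
    have h := ih.div (hb.add_const 1) (by norm_num)
    simp only [zero_add, div_one] at h
    refine h.congr' ?_
    filter_upwards [eventually_gt_atTop 0] with x hx
    have hkx : (k : ℝ) + x ≠ 0 := by positivity
    have hG : Real.Gamma (k + x) ≠ 0 := (Real.Gamma_pos_of_pos (by positivity)).ne'
    have hs : ((k + 1 : ℕ) : ℝ) + x = k + x + 1 := by push_cast; ring
    simp only [Pi.div_apply]
    rw [hs, Real.Gamma_add_one hkx]
    field_simp
    ring

/-- The PHP size prior is the `θ → ∞` limit of the generalized SHP size prior along
`φ = θ(1-α)/α`: for each `k`, the generalized SHP size probability converges to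
`(1-α)·α^k`. -/
theorem PHP_is_limit_of_generalized_SHP (α : ℝ) (hα : α ∈ Set.Ioo (0 : ℝ) 1)
    (k : ℕ) :
    Tendsto (fun θ : ℝ =>
        (((k : ℝ) + θ * (1 - α) / α) / ((k : ℝ) + θ * (1 - α) / α + θ)) *
          (Real.Gamma (θ * (1 - α) / α + θ) * θ ^ k /
            Real.Gamma ((k : ℝ) + θ * (1 - α) / α + θ)))
      atTop (nhds ((1 - α) * α ^ k)) := by
  obtain ⟨hα₀, -⟩ := hα
  have hx : Tendsto (fun θ : ℝ => θ / α) atTop atTop := tendsto_id.atTop_div_const hα₀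
  have h := ((tendsto_affine_div_add_atTop (1 - α) k).comp hx).mul
    (((tendsto_Gamma_mul_pow_div_Gamma_add k).comp hx).mul_const (α ^ k))
  rw [one_mul] at h
  refine h.congr fun θ => ?_
  have hsum : θ * (1 - α) / α + θ = θ / α := by field_simp; ring
  have hφ : θ * (1 - α) / α = (1 - α) * (θ / α) := by ring
  have hpow : (θ / α) ^ k * α ^ k = θ ^ k := by rw [← mul_pow, div_mul_cancel₀ _ hα₀.ne']
  simp only [Function.comp_apply]
  rw [add_assoc, hsum, hφ, ← hpow]
  ring
end

section
/- Let λ > 0 and fix an integer k ≥ 0. Under the Beta-Binomial(1, λp) prior, the induced size probability is π(k|p) = C(p,k)·B(k+1, p−k+λp)/B(1, λp), where B is the Beta function, and as p → ∞ this converges to (λ/(1+λ))·(1/(1+λ))^k, i.e., the limiting distribution on model size is Geometric with success probability λ/(1+λ). -/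
open Filter

/-- The Beta function `B(x,y) = Γ(x)Γ(y)/Γ(x+y)`. -/
noncomputable def betaFun (x y : ℝ) : ℝ :=
  Real.Gamma x * Real.Gamma y / Real.Gamma (x + y)

/-- The Beta-function recurrence `x B(x, y + 1) = y B(x + 1, y)`. -/
lemma betaFun_succ_left {x y : ℝ} (hx : x ≠ 0) (hy : y ≠ 0) :
    betaFun (x + 1) y = x / y * betaFun x (y + 1) := by
  unfold betaFun
  rw [Real.Gamma_add_one hx, Real.Gamma_add_one hy, show x + 1 + y = x + (y + 1) by ring]
  field_simp

lemma betaFun_one_left {y : ℝ} (hy : 0 < y) : betaFun 1 y = 1 / y := by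
  have hG := (Real.Gamma_pos_of_pos hy).ne'
  rw [betaFun, add_comm 1 y, Real.Gamma_add_one hy.ne', Real.Gamma_one]
  field_simp

/-- A ratio of affine functions of `p` tends to the ratio of the leading coefficients. -/
lemma tendsto_sub_div_mul_sub {c : ℝ} (hc : c ≠ 0) (a b : ℝ) :
    Tendsto (fun p : ℕ => ((p : ℝ) - a) / (c * p - b)) atTop (nhds (1 / c)) := by
  have h : Tendsto (fun p : ℕ => (1 - a / (p : ℝ)) / (c - b / (p : ℝ))) atTop
      (nhds ((1 - 0) / (c - 0))) :=
    (tendsto_const_nhds.sub (tendsto_const_div_atTop_nhds_zero_nat a)).div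
      (tendsto_const_nhds.sub (tendsto_const_div_atTop_nhds_zero_nat b)) (by simpa using hc)
  simp only [sub_zero] at h
  refine h.congr' ?_
  filter_upwards [eventually_gt_atTop 0] with p hp
  have hp' : (p : ℝ) ≠ 0 := by exact_mod_cast hp.ne'
  rw [← mul_div_mul_right _ _ hp', sub_mul, sub_mul, div_mul_cancel₀ _ hp',
    div_mul_cancel₀ _ hp', one_mul]

/-- Under the Beta-Binomial(1, λp) prior, the induced size probability
`π(k|p) = C(p,k)·B(k+1, p−k+λp)/B(1, λp)` converges, as `p → ∞`, to the
Geometric(λ/(1+λ)) mass `(λ/(1+λ))·(1/(1+λ))^k`. -/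
theorem BetaBinomial_one_lambda_p_geometric_limit (l : ℝ) (hl : 0 < l) (k : ℕ) :
    Tendsto (fun p : ℕ =>
        (p.choose k : ℝ) * betaFun ((k : ℝ) + 1) ((p : ℝ) - (k : ℝ) + l * p) /
          betaFun 1 (l * p))
      atTop (nhds ((l / (1 + l)) * (1 / (1 + l)) ^ k)) := by
  induction k with
  | zero =>
    refine tendsto_const_nhds.congr' ?_
    filter_upwards [eventually_gt_atTop 0] with p hp
    have hp' : (0 : ℝ) < p := by exact_mod_cast hp
    have hs : 0 < (p : ℝ) + l * p := by positivity
    simp only [Nat.choose_zero_right, Nat.cast_one, Nat.cast_zero, zero_add, sub_zero, pow_zero]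
    rw [betaFun_one_left hs, betaFun_one_left (mul_pos hl hp')]
    field_simp
  | succ k ih =>
    have h := ih.mul (tendsto_sub_div_mul_sub (c := 1 + l) (by positivity) (k : ℝ) ((k : ℝ) + 1))
    rw [mul_assoc, ← pow_succ] at h
    refine h.congr' ?_
    filter_upwards [eventually_gt_atTop (k + 1)] with p hp
    have hp' : (k : ℝ) + 1 < p := by exact_mod_cast hp
    have hlp : 0 < l * (p : ℝ) := mul_pos hl (by linarith [(Nat.cast_nonneg k : (0 : ℝ) ≤ k)])
    have hy : (p : ℝ) - ((k : ℝ) + 1) + l * p ≠ 0 := by linarith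
    have hk : (k : ℝ) + 1 ≠ 0 := by positivity
    have hchoose : (p.choose (k + 1) : ℝ) * ((k : ℝ) + 1) = p.choose k * ((p : ℝ) - k) := by
      rw [← Nat.cast_sub (by omega : k ≤ p)]
      exact_mod_cast Nat.choose_succ_right_eq p k
    push_cast
    rw [betaFun_succ_left hk hy,
      show (p : ℝ) - ((k : ℝ) + 1) + l * p + 1 = p - k + l * p by ring,
      show (1 + l) * (p : ℝ) - ((k : ℝ) + 1) = p - ((k : ℝ) + 1) + l * p by ring]
    linear_combination (-(betaFun ((k : ℝ) + 1) (p - k + l * p) / betaFun 1 (l * p) /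
      (p - ((k : ℝ) + 1) + l * p))) * hchoose
end

section
/- Let p ≥ 1 and ω > 0. Suppose π(·|p) is a probability distribution on {0,…,p} with π(k|p) > 0 for all k, satisfying the matryoshka doll recursion π(k|p) = ω·(k+1)·π(k+1|p) for every 0 ≤ k < p. Then π(k|p) = (ω^{−k}/k!) / (Σ_{j=0}^{p} ω^{−j}/j!) for every k = 0,…,p; that is, π(·|p) is the Poisson(1/ω) distribution truncated to {0,…,p}. -/
open Finset

/-- A solution of the matryoshka doll recursion is determined by its value at `0`. -/
theorem eq_zero_mul_of_matryoshka_rec {p : ℕ} {ω : ℝ} (hω : ω ≠ 0) {f : ℕ → ℝ}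
    (hrec : ∀ k, k < p → f k = ω * ((k : ℝ) + 1) * f (k + 1)) (k : ℕ) (hk : k ≤ p) :
    f k = f 0 * (ω⁻¹ ^ k / (k.factorial : ℝ)) := by
  induction k with
  | zero => simp
  | succ k ih =>
    have hk1 : (k : ℝ) + 1 ≠ 0 := Nat.cast_add_one_ne_zero k
    have hfac : (k.factorial : ℝ) ≠ 0 := Nat.cast_ne_zero.mpr k.factorial_ne_zero
    have hstep := (hrec k hk).symm.trans (ih (Nat.le_of_succ_le hk))
    apply mul_left_cancel₀ (mul_ne_zero hω hk1)
    rw [hstep, Nat.factorial_succ, inv_pow, inv_pow, pow_succ]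
    push_cast
    field_simp

/-- The matryoshka doll recursion `π(k|p) = ω·(k+1)·π(k+1|p)` for `0 ≤ k < p`,
together with `π(·|p)` being a positive probability distribution on `{0,…,p}`,
forces `π(·|p)` to be the Poisson(1/ω) distribution truncated to `{0,…,p}`. -/
theorem matryoshka_doll_is_truncated_poisson (p : ℕ) (hp : 1 ≤ p)
    (ω : ℝ) (hω : 0 < ω)
    (π : ℕ → ℝ) (hπpos : ∀ k, k ≤ p → 0 < π k)
    (hπsum : ∑ k ∈ Finset.range (p + 1), π k = 1)
    (hrec : ∀ k, k < p → π k = ω * ((k : ℝ) + 1) * π (k + 1)) :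
    ∀ k, k ≤ p →
      π k = (ω⁻¹ ^ k / (k.factorial : ℝ)) /
        ∑ j ∈ Finset.range (p + 1), ω⁻¹ ^ j / (j.factorial : ℝ) := by
  have hmul := eq_zero_mul_of_matryoshka_rec hω.ne' hrec
  have hnorm : π 0 * ∑ j ∈ Finset.range (p + 1), ω⁻¹ ^ j / (j.factorial : ℝ) = 1 := by
    rw [← hπsum, Finset.mul_sum]
    exact Finset.sum_congr rfl fun j hj =>
      (hmul j (Nat.lt_succ_iff.mp (Finset.mem_range.mp hj))).symm
  intro k hk
  rw [eq_div_iff (right_ne_zero_of_mul_eq_one hnorm), hmul k hk, mul_right_comm, hnorm, one_mul]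
end

section
/- Let Y be a real Gaussian random variable with mean 1/2 and variance 1/4, let m_k = E[Y^{2k}] denote its even moments, and let π(k|p) ∝ m_k/k! on {0,…,p} be the CMG size prior. Then for every 0 ≤ k < p the prior children-to-model ratio satisfies (k+1)·π(k+1|p)/π(k|p) = m_{k+1}/m_k, and for every integer k ≥ 1 this ratio lies strictly between (k+1)/2 and k+1: (k+1)/2 < m_{k+1}/m_k < k+1. -/
open Finset MeasureTheory ProbabilityTheory

/-- The even moments `m k = E[Y^{2k}]` of a Gaussian random variable `Y` with mean
`1/2` and variance `1/4`. -/
noncomputable def cmgMoment (k : ℕ) : ℝ :=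
  ∫ x, x ^ (2 * k) ∂(gaussianReal (1/2 : ℝ) (1/4 : NNReal))

open scoped NNReal

lemma integrable_pow_gaussianReal (μ : ℝ) (v : ℝ≥0) (n : ℕ) :
    Integrable (fun x ↦ x ^ n) (gaussianReal μ v) := by
  have h := (memLp_id_gaussianReal (μ := μ) (v := v) n).integrable_norm_pow'
  refine h.mono' (by fun_prop) (ae_of_all _ fun x ↦ ?_)
  simp

lemma integrable_gaussianPDFReal_mul_pow (μ : ℝ) {v : ℝ≥0} (hv : v ≠ 0) (n : ℕ) :
    Integrable (fun x ↦ gaussianPDFReal μ v x * x ^ n) := by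
  have h := integrable_pow_gaussianReal μ v n
  rw [gaussianReal_of_var_ne_zero μ hv, integrable_withDensity_iff_integrable_smul'
    (measurable_gaussianPDF μ v) (ae_of_all _ fun _ ↦ gaussianPDF_lt_top)] at h
  simpa [toReal_gaussianPDF] using h

lemma hasDerivAt_gaussianPDFReal (μ : ℝ) (v : ℝ≥0) (x : ℝ) :
    HasDerivAt (gaussianPDFReal μ v) (gaussianPDFReal μ v x * (-(x - μ) / v)) x := by
  rw [gaussianPDFReal_def]
  have h : HasDerivAt (fun y : ℝ ↦ -(y - μ) ^ 2 / (2 * v)) (-(x - μ) / v) x := by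
    refine ((((hasDerivAt_id x).sub_const μ).pow 2).neg.div_const (2 * (v : ℝ))).congr_deriv ?_
    rw [← mul_div_mul_left (-(x - μ)) (v : ℝ) two_ne_zero]
    simp [-neg_sub]
  refine (h.exp.const_mul (√(2 * Real.pi * v))⁻¹).congr_deriv ?_
  ring

/-- The moment recurrence of a Gaussian law, from integration by parts. -/
lemma integral_pow_add_two_gaussianReal (μ : ℝ) {v : ℝ≥0} (hv : v ≠ 0) (n : ℕ) :
    ∫ x, x ^ (n + 2) ∂(gaussianReal μ v) =
      μ * ∫ x, x ^ (n + 1) ∂(gaussianReal μ v) +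
        v * (n + 1) * ∫ x, x ^ n ∂(gaussianReal μ v) := by
  have hv' : (v : ℝ) ≠ 0 := by exact_mod_cast hv
  have hd (x : ℝ) : HasDerivAt (fun y ↦ v * (gaussianPDFReal μ v y * y ^ (n + 1)))
      (v * (n + 1) * (gaussianPDFReal μ v x * x ^ n) +
        μ * (gaussianPDFReal μ v x * x ^ (n + 1)) - gaussianPDFReal μ v x * x ^ (n + 2)) x := by
    refine (((hasDerivAt_gaussianPDFReal μ v x).mul (hasDerivAt_pow (n + 1) x)).const_mul
      (v : ℝ)).congr_deriv ?_
    push_cast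
    field_simp
    ring
  have hi := integrable_gaussianPDFReal_mul_pow μ hv
  have h₀ := (hi n).const_mul (v * (n + 1))
  have h₁ := (hi (n + 1)).const_mul μ
  have h := integral_eq_zero_of_hasDerivAt_of_integrable hd ((h₀.add h₁).sub (hi (n + 2)))
    ((hi (n + 1)).const_mul v)
  rw [integral_sub (by exact h₀.add h₁) (hi (n + 2)), integral_add h₀ h₁, integral_const_mul,
    integral_const_mul] at h
  simp only [integral_gaussianReal_eq_integral_smul hv, smul_eq_mul]
  linarith

/-- The moments of the Gaussian law with mean `1/2` and variance `1/4` are positive, and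
consecutive ones have ratio at least `1/2`. -/
lemma gaussianReal_moment_pos_and_half_le (n : ℕ) :
    0 < ∫ x, x ^ n ∂(gaussianReal (1/2 : ℝ) (1/4 : ℝ≥0)) ∧
      (∫ x, x ^ n ∂(gaussianReal (1/2 : ℝ) (1/4 : ℝ≥0))) / 2 ≤
        ∫ x, x ^ (n + 1) ∂(gaussianReal (1/2 : ℝ) (1/4 : ℝ≥0)) := by
  induction n with
  | zero => simp [integral_id_gaussianReal]
  | succ n ih =>
    obtain ⟨hpos, hle⟩ := ih
    refine ⟨by linarith, ?_⟩
    rw [integral_pow_add_two_gaussianReal (1/2) (by norm_num) n]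
    have : (0 : ℝ) ≤ ((1/4 : ℝ≥0) : ℝ) * (n + 1) *
        ∫ x, x ^ n ∂(gaussianReal (1/2 : ℝ) (1/4 : ℝ≥0)) := by positivity
    linarith

lemma cmgMoment_pos (k : ℕ) : 0 < cmgMoment k :=
  (gaussianReal_moment_pos_and_half_le (2 * k)).1

/-- Two-sided bounds on consecutive even moments. -/
lemma cmgMoment_succ_bounds {k : ℕ} (hk : 1 ≤ k) :
    ((k : ℝ) + 1) / 2 * cmgMoment k < cmgMoment (k + 1) ∧
      cmgMoment (k + 1) < ((k : ℝ) + 1) * cmgMoment k := by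
  obtain ⟨j, rfl⟩ := Nat.exists_eq_add_of_le' hk
  have hv : (1/4 : ℝ≥0) ≠ 0 := by norm_num
  have hodd := integral_pow_add_two_gaussianReal (1/2) hv (2 * j + 1)
  have heven := integral_pow_add_two_gaussianReal (1/2) hv (2 * j + 2)
  obtain ⟨hpos, hle⟩ := gaussianReal_moment_pos_and_half_le (2 * j + 1)
  have hm := cmgMoment_pos (j + 1)
  simp only [cmgMoment, mul_add, mul_one, add_assoc, Nat.reduceAdd] at *
  push_cast at *
  have hj : (0 : ℝ) ≤ j := j.cast_nonneg
  constructor <;> nlinarith [mul_pos (by positivity : (0 : ℝ) < j + 1) hpos,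
    mul_le_mul_of_nonneg_left hle (by positivity : (0 : ℝ) ≤ j + 1)]

/-- For the CMG size prior `π(k|p) ∝ m_k/k!`, where `m_k = E[Y^{2k}]` for
`Y ~ N(1/2, 1/4)`, the prior children-to-model ratio `(k+1)·π(k+1|p)/π(k|p)` equals
`m_{k+1}/m_k` for `k < p`, and for every `k ≥ 1` this ratio lies strictly between
`(k+1)/2` and `k+1`. -/
theorem CMG_children_to_model_ratio (p : ℕ) (hp : 1 ≤ p)
    (π : ℕ → ℝ) (hπ : ∀ k, k ≤ p → π k =
      (cmgMoment k / (k.factorial : ℝ)) /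
        ∑ j ∈ Finset.range (p + 1), cmgMoment j / (j.factorial : ℝ)) :
    (∀ k, k < p → ((k : ℝ) + 1) * π (k + 1) / π k = cmgMoment (k + 1) / cmgMoment k) ∧
      ∀ k : ℕ, 1 ≤ k →
        ((k : ℝ) + 1) / 2 < cmgMoment (k + 1) / cmgMoment k ∧
          cmgMoment (k + 1) / cmgMoment k < (k : ℝ) + 1 := by
  refine ⟨fun k hk ↦ ?_, fun k hk ↦ ?_⟩
  · have hS : 0 < ∑ j ∈ Finset.range (p + 1), cmgMoment j / (j.factorial : ℝ) :=
      Finset.sum_pos (fun j _ ↦ div_pos (cmgMoment_pos j) (by positivity)) (by simp)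
    have hm := cmgMoment_pos k
    rw [hπ k hk.le, hπ (k + 1) hk, Nat.factorial_succ]
    push_cast
    field_simp
  · rw [lt_div_iff₀ (cmgMoment_pos k), div_lt_iff₀ (cmgMoment_pos k)]
    exact cmgMoment_succ_bounds hk
end
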